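/- Let $F$ be a field with $\operatorname{char} F\neq 2$, let $\alpha,\beta\in F\setminus\{0,1\}$ with $\alpha\neq\beta$, and let $V$ be a commutative, not necessarily associative or unital, $F$-algebra. For $a\in V$ and $\mu\in F$ put $V_\mu^a=\{v\in V: av=\mu v\}$. A *primitive axis of Monster type $(\alpha,\beta)$* is a nonzero idempotent $a\in V$ such that $V=V_1^a\oplus V_0^a\oplus V_\alpha^a\oplus V_\beta^a$, $V_1^a=Fa$, and the fusion law $\mathcal M(\alpha,\beta)$ holds: $V_1^aV_0^a=0$; $V_1^aV_\mu^a\subseteq V_\mu^a$ for $\mu\in\{1,\alpha,\beta\}$; $V_0^aV_\mu^a\subseteq V_\mu^a$ for $\mu\in\{0,\alpha,\beta\}$; $V_\alpha^aV_\alpha^a\subseteq V_1^a+V_0^a$; $V_\alpha^aV_\beta^a\subseteq V_\beta^a$; $V_\beta^aV_\beta^a\subseteq V_1^a+V_0^a+V_\alpha^a$. A *primitive axis of Jordan type $\alpha$* is a nonzero idempotent $a\in V$ such that $V=V_1^a\oplus V_0^a\oplus V_\alpha^a$, $V_1^a=Fa$, and those of the above inclusions that do not involve $V_\beta^a$ (the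 fusion law $\mathcal J(\alpha)$) hold. The Miyamoto involution $\tau_a$ of a primitive axis $a$ of Monster type $(\alpha,\beta)$ is the linear map (an algebra automorphism) that fixes $V_1^a+V_0^a+V_\alpha^a$ pointwise and acts as $-1$ on $V_\beta^a$. Let $\mathcal V=(V,\{a_0,a_1\})$ be a primitive $2$-generated $\mathcal M(\alpha,\beta)$-axial algebra over $F$, that is, $a_0,a_1$ are (not necessarily distinct) primitive axes of Monster type $(\alpha,\beta)$ which generate $V$ as an $F$-algebra. Write $\tau_i=\tau_{a_i}$ for $i\in\{0,1\}$ and $\rho=\tau_0\tau_1$ (maps act on the right), and set $a_{2i}=a_0^{\rho^i}$, $a_{2i+1}=a_1^{\rho^i}$ for $i\in\mathbb Z$. Say that $\mathcal V$ has a *skew axet* if the orbits of $a_0$ and $a_1$ under the group $\langle\tau_0,\tau_1\rangle$ have different cardinalities. If $a_0=a_2$ or $a_1=a_{-1}$, then at least one of the following holds: 1. $\mathcal V$ is an axial algebra of Jordan type: $V_\beta^{a_0}=V_\beta^{a_1}=0$, so that $a_0$ and $a_1$ are primitive axes of Jordan type $\alpha$; and moreover $\mathcal V$ is symmetric, i.e.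 there is an $F$-algebra automorphism $f$ of $V$ with $f(a_0)=a_1$ and $f(a_1)=a_0$; 2. $\mathcal V$ has a skew axet. -/

import Mathlib

namespace AxialFormal

universe u v

section

variable (F : Type u) [Field F] {V : Type v} [NonUnitalNonAssocCommRing V]
  [Module F V] [SMulCommClass F V V]

/-- The `μ`-eigenspace `V_μ^a` of the adjoint map `ad_a : x ↦ a * x`. -/
def eigSp (a : V) (μ : F) : Submodule F V :=
  Module.End.eigenspace (LinearMap.mulLeft F a) μ

theorem mem_eigSp (a : V) (μ : F) (w : V) : w ∈ eigSp F a μ ↔ a * w = μ • w := by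
  simp [eigSp]

/-- `a` is a primitive axis of Monster type `(α, β)` in the commutative
(not necessarily associative or unital) `F`-algebra `V`. Axes are nonzero by convention. -/
structure IsAxis (α β : F) (a : V) : Prop where
  ne_zero : a ≠ 0
  idem : a * a = a
  primitive : eigSp F a 1 = Submodule.span F {a}
  decomp : DirectSum.IsInternal (fun i : Fin 4 => eigSp F a (![1, 0, α, β] i))
  fusion_one_one : ∀ u ∈ eigSp F a 1, ∀ w ∈ eigSp F a 1, u * w ∈ eigSp F a 1
  fusion_one_zero : ∀ u ∈ eigSp F a 1, ∀ w ∈ eigSp F a 0, u * w = 0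
  fusion_one_alpha : ∀ u ∈ eigSp F a 1, ∀ w ∈ eigSp F a α, u * w ∈ eigSp F a α
  fusion_one_beta : ∀ u ∈ eigSp F a 1, ∀ w ∈ eigSp F a β, u * w ∈ eigSp F a β
  fusion_zero_zero : ∀ u ∈ eigSp F a 0, ∀ w ∈ eigSp F a 0, u * w ∈ eigSp F a 0
  fusion_zero_alpha : ∀ u ∈ eigSp F a 0, ∀ w ∈ eigSp F a α, u * w ∈ eigSp F a α
  fusion_zero_beta : ∀ u ∈ eigSp F a 0, ∀ w ∈ eigSp F a β, u * w ∈ eigSp F a β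
  fusion_alpha_alpha : ∀ u ∈ eigSp F a α, ∀ w ∈ eigSp F a α,
    u * w ∈ eigSp F a 1 ⊔ eigSp F a 0
  fusion_alpha_beta : ∀ u ∈ eigSp F a α, ∀ w ∈ eigSp F a β, u * w ∈ eigSp F a β
  fusion_beta_beta : ∀ u ∈ eigSp F a β, ∀ w ∈ eigSp F a β,
    u * w ∈ eigSp F a 1 ⊔ eigSp F a 0 ⊔ eigSp F a α

/-- `a` is a primitive axis of Jordan type `η`. -/
structure IsJordanAxis (η : F) (a : V) : Prop where
  ne_zero : a ≠ 0
  idem : a * a = a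
  primitive : eigSp F a 1 = Submodule.span F {a}
  decomp : DirectSum.IsInternal (fun i : Fin 3 => eigSp F a (![1, 0, η] i))
  fusion_one_one : ∀ u ∈ eigSp F a 1, ∀ w ∈ eigSp F a 1, u * w ∈ eigSp F a 1
  fusion_one_zero : ∀ u ∈ eigSp F a 1, ∀ w ∈ eigSp F a 0, u * w = 0
  fusion_one_eta : ∀ u ∈ eigSp F a 1, ∀ w ∈ eigSp F a η, u * w ∈ eigSp F a η
  fusion_zero_zero : ∀ u ∈ eigSp F a 0, ∀ w ∈ eigSp F a 0, u * w ∈ eigSp F a 0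
  fusion_zero_eta : ∀ u ∈ eigSp F a 0, ∀ w ∈ eigSp F a η, u * w ∈ eigSp F a η
  fusion_eta_eta : ∀ u ∈ eigSp F a η, ∀ w ∈ eigSp F a η,
    u * w ∈ eigSp F a 1 ⊔ eigSp F a 0

/-- `V_+^a = V_1^a + V_0^a + V_α^a`. -/
def plusPart (α : F) (a : V) : Submodule F V :=
  eigSp F a 1 ⊔ eigSp F a 0 ⊔ eigSp F a α

/-- The direct sum decomposition of an axis gives `V = V_+^a ⊕ V_β^a`. -/
theorem IsAxis.isCompl {F : Type u} [Field F] {V : Type v} [NonUnitalNonAssocCommRing V]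
    [Module F V] [SMulCommClass F V V] {α β : F} {a : V} (h : IsAxis F α β a) :
    IsCompl (plusPart F α a) (eigSp F a β) := by
  have hs := h.decomp.submodule_iSup_eq_top
  have hi := h.decomp.submodule_iSupIndep
  constructor
  · have h3 := (hi 3).symm
    refine h3.mono_left ?_
    refine sup_le (sup_le ?_ ?_) ?_
    · exact le_iSup₂_of_le (0 : Fin 4) (by decide) le_rfl
    · exact le_iSup₂_of_le (1 : Fin 4) (by decide) le_rfl
    · exact le_iSup₂_of_le (2 : Fin 4) (by decide) le_rfl
  · rw [codisjoint_iff, eq_top_iff, ← hs]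
    refine iSup_le fun i => ?_
    fin_cases i
    · exact le_sup_of_le_left (le_sup_of_le_left le_sup_left)
    · exact le_sup_of_le_left (le_sup_of_le_left le_sup_right)
    · exact le_sup_of_le_left le_sup_right
    · exact le_sup_right

/-- The Miyamoto involution `τ_a` of an axis `a`: the linear map which is the identity on
`V_+^a` and minus the identity on `V_β^a`. -/
noncomputable def miyamoto {F : Type u} [Field F] {V : Type v} [NonUnitalNonAssocCommRing V]
    [Module F V] [SMulCommClass F V V] {α β : F} {a : V} (h : IsAxis F α β a) : V ≃ₗ[F] V :=
  (Submodule.prodEquivOfIsCompl _ _ h.isCompl).symm ≪≫ₗ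
    (LinearEquiv.prodCongr (LinearEquiv.refl F (plusPart F α a))
      (LinearEquiv.neg F : eigSp F a β ≃ₗ[F] eigSp F a β)) ≪≫ₗ
    Submodule.prodEquivOfIsCompl _ _ h.isCompl

theorem miyamoto_plus {F : Type u} [Field F] {V : Type v} [NonUnitalNonAssocCommRing V]
    [Module F V] [SMulCommClass F V V] {α β : F} {a : V} (h : IsAxis F α β a)
    {w : V} (hw : w ∈ plusPart F α a) : miyamoto h w = w := by
  have := Submodule.prodEquivOfIsCompl_symm_apply_left _ _ h.isCompl ⟨w, hw⟩
  simp only at this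
  simp [miyamoto, this]

theorem miyamoto_beta {F : Type u} [Field F] {V : Type v} [NonUnitalNonAssocCommRing V]
    [Module F V] [SMulCommClass F V V] {α β : F} {a : V} (h : IsAxis F α β a)
    {w : V} (hw : w ∈ eigSp F a β) : miyamoto h w = -w := by
  have := Submodule.prodEquivOfIsCompl_symm_apply_right _ _ h.isCompl ⟨w, hw⟩
  simp only at this
  simp [miyamoto, this]

end

section

variable {F : Type u} [Field F] {V : Type v} [NonUnitalNonAssocCommRing V]
  [Module F V] [SMulCommClass F V V] [IsScalarTower F V V]

variable (F) in
/-- `(V, {a₀, a₁})` is a primitive 2-generated axial algebra of Monster type `(α, β)`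
(`a₀ = a₁` is allowed). -/
structure IsTwoGenerated (α β : F) (a₀ a₁ : V) : Prop where
  axis₀ : IsAxis F α β a₀
  axis₁ : IsAxis F α β a₁
  generates : NonUnitalAlgebra.adjoin F {a₀, a₁} = ⊤

variable (F) in
/-- `(V, {a₀, a₁})` is a primitive 2-generated axial algebra of Jordan type `η`. -/
structure IsTwoGeneratedJordan (η : F) (a₀ a₁ : V) : Prop where
  axis₀ : IsJordanAxis F η a₀
  axis₁ : IsJordanAxis F η a₁
  generates : NonUnitalAlgebra.adjoin F {a₀, a₁} = ⊤

variable (F) in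
/-- `(V, {a₀, a₁})` is symmetric: there is an algebra automorphism interchanging
`a₀` and `a₁`. -/
def IsSymmetric (a₀ a₁ : V) : Prop :=
  ∃ f : V ≃ₗ[F] V, (∀ x y : V, f (x * y) = f x * f y) ∧ f a₀ = a₁ ∧ f a₁ = a₀

namespace IsTwoGenerated

variable {α β : F} {a₀ a₁ : V}

/-- `ρ = τ₀τ₁`, where maps act on the right: `v^ρ = (v^τ₀)^τ₁`. -/
noncomputable def rho (hV : IsTwoGenerated F α β a₀ a₁) : V ≃ₗ[F] V :=
  miyamoto hV.axis₁ * miyamoto hV.axis₀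

/-- The sequence of axes `a_j`, `j ∈ ℤ`, with `a_{2i} = a₀^{ρ^i}` and `a_{2i+1} = a₁^{ρ^i}`. -/
noncomputable def axSeq (hV : IsTwoGenerated F α β a₀ a₁) (j : ℤ) : V :=
  if j % 2 = 0 then (hV.rho ^ (j / 2)) a₀ else (hV.rho ^ ((j - 1) / 2)) a₁

/-- The Miyamoto group `⟨τ₀, τ₁⟩`. -/
def miy (hV : IsTwoGenerated F α β a₀ a₁) : Subgroup (V ≃ₗ[F] V) :=
  Subgroup.closure {miyamoto hV.axis₀, miyamoto hV.axis₁}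

/-- The orbits of `a₀` and `a₁` under the Miyamoto group have the same cardinality. -/
def HasRegularAxet (hV : IsTwoGenerated F α β a₀ a₁) : Prop :=
  Cardinal.mk (MulAction.orbit hV.miy a₀) = Cardinal.mk (MulAction.orbit hV.miy a₁)

/-- The orbits of `a₀` and `a₁` under the Miyamoto group have different cardinalities. -/
def HasSkewAxet (hV : IsTwoGenerated F α β a₀ a₁) : Prop :=
  ¬ hV.HasRegularAxet

end IsTwoGenerated

end

end AxialFormal

namespace AxialFormal

universe u v

section Sigma

variable {F : Type u} [Field F] {V : Type v} [NonUnitalNonAssocCommRing V] [Module F V]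

/-- The vector `σ = ab - ηa - ηb` of a pair of axes of Jordan type `η`. -/
def sigma (η : F) (a b : V) : V := a * b - η • a - η • b

theorem sigma_comm (η : F) (a b : V) : sigma η b a = sigma η a b := by
  simp only [sigma, mul_comm b a]
  abel

theorem mul_eq_sigma (η : F) (a b : V) : a * b = sigma η a b + η • a + η • b := by
  simp only [sigma]
  abel

/-- The linear map `F³ → V` with `(x, y, z) ↦ x a + y b + z s`. -/
def tripleMap (a b s : V) : (F × F × F) →ₗ[F] V :=
  (LinearMap.toSpanSingleton F V a).coprod
    ((LinearMap.toSpanSingleton F V b).coprod (LinearMap.toSpanSingleton F V s))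

theorem tripleMap_apply (a b s : V) (x y z : F) :
    tripleMap a b s (x, y, z) = x • a + y • b + z • s := by
  simp [tripleMap, add_assoc]

end Sigma

section Jordan

variable {F : Type u} [Field F] {V : Type v} [NonUnitalNonAssocCommRing V]
  [Module F V] [SMulCommClass F V V]

theorem IsAxis.isJordanAxis {α β : F} {a : V} (h : IsAxis F α β a)
    (hβ : eigSp F a β = ⊥) : IsJordanAxis F α a where
  ne_zero := h.ne_zero
  idem := h.idem
  primitive := h.primitive
  decomp := by
    rw [DirectSum.isInternal_submodule_iff_iSupIndep_and_iSup_eq_top]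
    have hind := h.decomp.submodule_iSupIndep.comp (Fin.castSucc_injective 3)
    have hfun : ((fun i : Fin 4 => eigSp F a (![1, 0, α, β] i)) ∘ Fin.castSucc) =
        fun i : Fin 3 => eigSp F a (![1, 0, α] i) := by
      funext i
      fin_cases i <;> rfl
    rw [hfun] at hind
    refine ⟨hind, ?_⟩
    rw [eq_top_iff, ← h.decomp.submodule_iSup_eq_top]
    refine iSup_le fun i => ?_
    fin_cases i
    · exact le_iSup (fun i : Fin 3 => eigSp F a (![1, 0, α] i)) 0
    · exact le_iSup (fun i : Fin 3 => eigSp F a (![1, 0, α] i)) 1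
    · exact le_iSup (fun i : Fin 3 => eigSp F a (![1, 0, α] i)) 2
    · exact hβ.le.trans bot_le
  fusion_one_one := h.fusion_one_one
  fusion_one_zero := h.fusion_one_zero
  fusion_one_eta := h.fusion_one_alpha
  fusion_zero_zero := h.fusion_zero_zero
  fusion_zero_eta := h.fusion_zero_alpha
  fusion_eta_eta := h.fusion_alpha_alpha

variable {η : F} {a : V}

theorem IsJordanAxis.exists_components (h : IsJordanAxis F η a) (b : V) :
    ∃ (φ : F) (b₀ bη : V), a * b₀ = 0 ∧ a * bη = η • bη ∧ b = φ • a + b₀ + bη := by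
  have hb : b ∈ eigSp F a 1 ⊔ eigSp F a 0 ⊔ eigSp F a η := by
    have hle : (⊤ : Submodule F V) ≤ eigSp F a 1 ⊔ eigSp F a 0 ⊔ eigSp F a η := by
      rw [← h.decomp.submodule_iSup_eq_top]
      refine iSup_le fun i => ?_
      fin_cases i
      · exact le_sup_of_le_left le_sup_left
      · exact le_sup_of_le_left le_sup_right
      · exact le_sup_right
    exact hle Submodule.mem_top
  obtain ⟨w, hw, bη, hη, rfl⟩ := Submodule.mem_sup.1 hb
  obtain ⟨u, hu, b₀, h₀, rfl⟩ := Submodule.mem_sup.1 hw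
  rw [h.primitive] at hu
  obtain ⟨φ, rfl⟩ := Submodule.mem_span_singleton.1 hu
  refine ⟨φ, b₀, bη, ?_, (mem_eigSp F a η bη).1 hη, rfl⟩
  simpa using (mem_eigSp F a 0 b₀).1 h₀

/-- The components of a vector with respect to an axis are unique. -/
theorem IsJordanAxis.components_eq_zero (h : IsJordanAxis F η a) (hη0 : η ≠ 0) (hη1 : η ≠ 1)
    {x : F} {u w : V} (hu : a * u = 0) (hw : a * w = η • w) (hsum : x • a + u + w = 0) :
    x = 0 ∧ u = 0 ∧ w = 0 := by
  have e1 : x • a + η • w = 0 := by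
    have := congrArg (a * ·) hsum
    simpa [mul_add, mul_smul_comm, h.idem, hu, hw] using this
  have e2 : x • a + (η * η) • w = 0 := by
    have := congrArg (a * ·) e1
    simpa [mul_add, mul_smul_comm, h.idem, hw, smul_smul] using this
  have e3 : (η * (η - 1)) • w = 0 := by
    have : (η * (η - 1)) • w = (x • a + (η * η) • w) - (x • a + η • w) := by module
    rw [this, e1, e2, sub_zero]
  have hw0 : w = 0 :=
    (smul_eq_zero.1 e3).resolve_left (mul_ne_zero hη0 (sub_ne_zero.2 hη1))
  have hx : x = 0 := by
    rw [hw0, smul_zero, add_zero] at e1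
    exact (smul_eq_zero.1 e1).resolve_right h.ne_zero
  refine ⟨hx, ?_, hw0⟩
  simpa [hx, hw0] using hsum

variable {b : V}

theorem IsJordanAxis.sigma_eq (h : IsJordanAxis F η a) {φ : F} {b₀ bη : V}
    (h0 : a * b₀ = 0) (hη : a * bη = η • bη) (hb : b = φ • a + b₀ + bη) :
    sigma η a b = (φ - η - η * φ) • a - η • b₀ := by
  subst hb
  simp only [sigma, mul_add, mul_smul_comm, h.idem, h0, hη]
  module

theorem IsJordanAxis.mul_sigma (h : IsJordanAxis F η a) {φ : F} {b₀ bη : V}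
    (h0 : a * b₀ = 0) (hη : a * bη = η • bη) (hb : b = φ • a + b₀ + bη) :
    a * sigma η a b = (φ - η - η * φ) • a := by
  rw [h.sigma_eq h0 hη hb, mul_sub, mul_smul_comm, mul_smul_comm, h.idem, h0, smul_zero, sub_zero]

theorem IsJordanAxis.relation (h : IsJordanAxis F η a) (hη0 : η ≠ 0) (hη1 : η ≠ 1)
    {φ : F} {b₀ bη : V}
    (h0 : a * b₀ = 0) (hη : a * bη = η • bη) (hb : b = φ • a + b₀ + bη) {x y z : F}
    (hrel : x • a + y • b + z • sigma η a b = 0) :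
    x + y * φ + z * (φ - η - η * φ) = 0 ∧ y • bη = 0 := by
  have hs := h.sigma_eq h0 hη hb
  have key : (x + y * φ + z * (φ - η - η * φ)) • a + (y - z * η) • b₀ + y • bη = 0 := by
    rw [← hrel, hs, hb]
    module
  obtain ⟨k1, -, k3⟩ := h.components_eq_zero hη0 hη1
    (by rw [mul_smul_comm, h0, smul_zero]) (by rw [mul_smul_comm, hη, smul_comm]) key
  exact ⟨k1, k3⟩


variable [IsScalarTower F V V]

/-- If `b * σ = p b`, compare the components of both sides with respect to `a`. -/
theorem IsJordanAxis.compare_components (h : IsJordanAxis F η a) (hη0 : η ≠ 0) (hη1 : η ≠ 1)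
    {φ p : F} {b₀ bη : V}
    (h0 : a * b₀ = 0) (hη : a * bη = η • bη) (hb : b = φ • a + b₀ + bη)
    (hp : b * sigma η a b = p • b) :
    φ * ((φ - η - η * φ) - p) = 0 ∧
      sigma η a b * sigma η a b =
        ((φ - η - η * φ) * ((φ - η - η * φ) - p)) • a + p • sigma η a b := by
  have hs := h.sigma_eq h0 hη hb
  set π := φ - η - η * φ with hπ
  have m0 : b₀ ∈ eigSp F a 0 := by rw [mem_eigSp, h0, zero_smul]
  have mη : bη ∈ eigSp F a η := by rw [mem_eigSp, hη]
  have h00 : a * (b₀ * b₀) = 0 := by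
    simpa using (mem_eigSp F a 0 _).1 (h.fusion_zero_zero _ m0 _ m0)
  have h0η : a * (b₀ * bη) = η • (b₀ * bη) :=
    (mem_eigSp F a η _).1 (h.fusion_zero_eta _ m0 _ mη)
  have ha0 : b₀ * a = 0 := by rw [mul_comm, h0]
  have haη : bη * a = η • bη := by rw [mul_comm, hη]
  have key : (φ * (π - p)) • a + (-(η • (b₀ * b₀)) - p • b₀) +
      ((π * η - p) • bη - η • (b₀ * bη)) = 0 := by
    have : b * sigma η a b - p • b = 0 := sub_eq_zero.2 hp
    rw [hs, hb] at this
    simp only [mul_sub, add_mul, mul_smul_comm, smul_mul_assoc, h.idem, ha0, haη, h0,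
      mul_comm bη b₀] at this
    rw [← this]
    module
  obtain ⟨k1, k2, -⟩ := h.components_eq_zero hη0 hη1
    (by simp [mul_sub, mul_smul_comm, h00, h0])
    (by simp only [mul_sub, mul_smul_comm, hη, h0η]; module) key
  refine ⟨k1, ?_⟩
  have k3 : η • (b₀ * b₀) = -(p • b₀) := by
    have := eq_of_sub_eq_zero k2
    rw [← this, neg_neg]
  rw [hs]
  simp only [mul_sub, sub_mul, mul_smul_comm, smul_mul_assoc, h.idem, h0, ha0, k3]
  module

/-- The multiplication table of an algebra generated by two axes of Jordan type. -/
theorem IsTwoGeneratedJordan.table {a b : V} (h : IsTwoGeneratedJordan F η a b)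
    (hη0 : η ≠ 0) (hη1 : η ≠ 1) :
    ∃ φ : F, (∃ b₀ bη : V, a * b₀ = 0 ∧ a * bη = η • bη ∧ b = φ • a + b₀ + bη) ∧
      (∃ a₀ aη : V, b * a₀ = 0 ∧ b * aη = η • aη ∧ a = φ • b + a₀ + aη) ∧
      a * sigma η a b = (φ - η - η * φ) • a ∧ b * sigma η a b = (φ - η - η * φ) • b ∧
      sigma η a b * sigma η a b = (φ - η - η * φ) • sigma η a b := by
  obtain ⟨φ, b₀, bη, h0, hη, hb⟩ := h.axis₀.exists_components b
  obtain ⟨ψ, a₀, aη, h0', hη', ha⟩ := h.axis₁.exists_components a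
  have m1 := h.axis₀.mul_sigma h0 hη hb
  have m2 := h.axis₁.mul_sigma h0' hη' ha
  have c2 := (h.axis₁.compare_components hη0 hη1 h0' hη' ha (by rw [sigma_comm]; exact m1)).1
  rw [sigma_comm] at m2
  obtain ⟨c1, s1⟩ := h.axis₀.compare_components hη0 hη1 h0 hη hb m2
  have hη1' : (1 : F) - η ≠ 0 := sub_ne_zero.2 (Ne.symm hη1)
  have hφψ : φ = ψ := by
    have d1 : φ * (φ - ψ) = 0 := by
      refine (mul_eq_zero.1 (?_ : (1 - η) * (φ * (φ - ψ)) = 0)).resolve_left hη1'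
      linear_combination c1
    have d2 : ψ * (φ - ψ) = 0 := by
      refine (mul_eq_zero.1 (?_ : (1 - η) * (ψ * (φ - ψ)) = 0)).resolve_left hη1'
      linear_combination -c2
    have d3 : (φ - ψ) * (φ - ψ) = 0 := by linear_combination d1 - d2
    exact sub_eq_zero.1 (mul_self_eq_zero.1 d3)
  subst hφψ
  refine ⟨φ, ⟨b₀, bη, h0, hη, hb⟩, ⟨a₀, aη, h0', hη', ha⟩, m1, m2, ?_⟩
  rw [s1, sub_self, mul_zero, zero_smul, zero_add]

theorem tripleMap_mul {a b s : V} {π : F} (haa : a * a = a) (hbb : b * b = b)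
    (hab : a * b = s + η • a + η • b) (has : a * s = π • a) (hbs : b * s = π • b)
    (hss : s * s = π • s) (x y z x' y' z' : F) :
    tripleMap a b s (x, y, z) * tripleMap a b s (x', y', z') =
      tripleMap a b s (x * x' + η * (x * y' + y * x') + π * (x * z' + z * x'),
        y * y' + η * (x * y' + y * x') + π * (y * z' + z * y'),
        x * y' + y * x' + π * (z * z')) := by
  simp only [tripleMap_apply, mul_add, add_mul, mul_smul_comm, smul_mul_assoc, haa, hbb, hab,
    mul_comm b a, mul_comm s a, mul_comm s b, has, hbs, hss]
  module

theorem IsJordanAxis.eq_of_mul_eq (hb : IsJordanAxis F η b) (ha : IsJordanAxis F η a)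
    (h : b * a = a) : a = b := by
  have hmem : a ∈ eigSp F b 1 := by rw [mem_eigSp, h, one_smul]
  rw [hb.primitive] at hmem
  obtain ⟨c, rfl⟩ := Submodule.mem_span_singleton.1 hmem
  have hc : c ≠ 0 := fun hc => ha.ne_zero (by rw [hc, zero_smul])
  have hi := ha.idem
  rw [smul_mul_assoc, h] at hi
  have h1 : c • b = b := smul_right_injective V hc hi
  exact h1

/-- Linear relations between `a`, `b` and `σ` are preserved by interchanging `a` and `b`. -/
theorem IsTwoGeneratedJordan.relation_swap {a b : V} (h : IsTwoGeneratedJordan F η a b)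
    (hη0 : η ≠ 0) (hη1 : η ≠ 1) {x y z : F}
    (hrel : x • a + y • b + z • sigma η a b = 0) :
    y • a + x • b + z • sigma η a b = 0 := by
  obtain ⟨φ, ⟨b₀, bη, h0, hη, hb⟩, ⟨a₀, aη, h0', hη', ha⟩, -⟩ := h.table hη0 hη1
  obtain ⟨r1, r2⟩ := h.axis₀.relation hη0 hη1 h0 hη hb hrel
  have hrel' : y • b + x • a + z • sigma η b a = 0 := by
    rw [sigma_comm, add_comm (y • b)]
    exact hrel
  obtain ⟨s1, s2⟩ := h.axis₁.relation hη0 hη1 h0' hη' ha hrel'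
  have hprod : (x - y) * (1 - φ) = 0 := by linear_combination r1 - s1
  rcases mul_eq_zero.1 hprod with hxy | hφ
  · rw [sub_eq_zero] at hxy
    subst hxy
    exact hrel
  · have hφ1 : φ = 1 := (sub_eq_zero.1 hφ).symm
    subst hφ1
    rw [one_smul] at ha hb
    have hab : bη = 0 ∨ aη = 0 → a = b := by
      rintro (hz | hz)
      · refine h.axis₁.eq_of_mul_eq h.axis₀ ?_
        rw [hb, hz, add_zero, add_mul, h.axis₀.idem, mul_comm, h0, add_zero]
      · refine (h.axis₀.eq_of_mul_eq h.axis₁ ?_).symm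
        rw [ha, hz, add_zero, add_mul, h.axis₁.idem, mul_comm, h0', add_zero]
    rcases smul_eq_zero.1 r2 with hy | hz
    · rcases smul_eq_zero.1 s2 with hx | hz
      · rw [hx, hy] at hrel ⊢
        exact hrel
      · rw [hab (Or.inr hz)] at hrel ⊢
        rw [add_comm (y • b)]
        exact hrel
    · rw [hab (Or.inl hz)] at hrel ⊢
      rw [add_comm (y • b)]
      exact hrel

theorem IsTwoGeneratedJordan.isSymmetric {a b : V} (h : IsTwoGeneratedJordan F η a b)
    (hη0 : η ≠ 0) (hη1 : η ≠ 1) : IsSymmetric F a b := by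
  obtain ⟨φ, -, -, has, hbs, hss⟩ := h.table hη0 hη1
  have hab := mul_eq_sigma η a b
  have hswap := fun x y z => h.relation_swap hη0 hη1 (x := x) (y := y) (z := z)
  generalize sigma η a b = s at *
  generalize φ - η - η * φ = π at *
  have hmul := tripleMap_mul h.axis₀.idem h.axis₁.idem hab has hbs hss
  set g := tripleMap (F := F) a b s with hg
  have ga : g (1, 0, 0) = a := by simp [hg, tripleMap_apply]
  have gb : g (0, 1, 0) = b := by simp [hg, tripleMap_apply]
  have hsurj : Function.Surjective g := by
    intro v
    have hv : v ∈ NonUnitalAlgebra.adjoin F {a, b} := by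
      rw [h.generates]
      trivial
    induction hv using NonUnitalAlgebra.adjoin_induction with
    | mem x hx =>
      rcases hx with rfl | rfl
      · exact ⟨_, ga⟩
      · exact ⟨_, gb⟩
    | add x y _ _ hx hy =>
      obtain ⟨p, rfl⟩ := hx
      obtain ⟨q, rfl⟩ := hy
      exact ⟨p + q, map_add g p q⟩
    | zero => exact ⟨0, map_zero g⟩
    | mul x y _ _ hx hy =>
      obtain ⟨⟨p₁, p₂, p₃⟩, rfl⟩ := hx
      obtain ⟨⟨q₁, q₂, q₃⟩, rfl⟩ := hy
      exact ⟨_, (hmul _ _ _ _ _ _).symm⟩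
    | smul r x _ hx =>
      obtain ⟨p, rfl⟩ := hx
      exact ⟨r • p, map_smul g r p⟩
  obtain ⟨k, hk⟩ := g.exists_rightInverse_of_surjective (LinearMap.range_eq_top.2 hsurj)
  have hk' : ∀ v, g (k v) = v := fun v => LinearMap.congr_fun hk v
  let sw : (F × F × F) →ₗ[F] (F × F × F) :=
    { toFun := fun p => (p.2.1, p.1, p.2.2)
      map_add' := fun _ _ => rfl
      map_smul' := fun _ _ => rfl }
  have hker : ∀ p, g p = 0 → g (sw p) = 0 := by
    rintro ⟨x, y, z⟩ hp
    rw [hg, tripleMap_apply] at hp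
    exact (tripleMap_apply a b s y x z).trans (hswap x y z hp)
  let f : V →ₗ[F] V := g ∘ₗ sw ∘ₗ k
  have hf : ∀ p, f (g p) = g (sw p) := by
    intro p
    have := hker (k (g p) - p) (by rw [map_sub, hk', sub_self])
    rw [map_sub, map_sub] at this
    exact sub_eq_zero.1 this
  have hinv : Function.Involutive f := by
    intro v
    obtain ⟨p, rfl⟩ := hsurj v
    rw [hf, hf]
    rfl
  refine ⟨LinearEquiv.ofInvolutive f hinv, ?_, ?_, ?_⟩
  · intro v w
    obtain ⟨⟨x, y, z⟩, rfl⟩ := hsurj v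
    obtain ⟨⟨x', y', z'⟩, rfl⟩ := hsurj w
    change f _ = f _ * f _
    rw [hmul, hf, hf, hf]
    change g (_, _, _) = g (y, x, z) * g (y', x', z')
    rw [hmul]
    congr 2
    · ring
    · congr 1 <;> ring
  · change f a = b
    rw [← ga, hf]
    exact gb
  · change f b = a
    rw [← gb, hf]
    exact ga

end Jordan

section Miyamoto

variable {F : Type u} [Field F] {V : Type v} [NonUnitalNonAssocCommRing V]
  [Module F V] [SMulCommClass F V V] {α β : F} {a : V}

theorem IsAxis.exists_plus_beta (h : IsAxis F α β a) (v : V) :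
    ∃ p ∈ plusPart F α a, ∃ q ∈ eigSp F a β, v = p + q := by
  have hv : v ∈ plusPart F α a ⊔ eigSp F a β := by
    rw [h.isCompl.sup_eq_top]
    trivial
  obtain ⟨p, hp, q, hq, e⟩ := Submodule.mem_sup.1 hv
  exact ⟨p, hp, q, hq, e.symm⟩

theorem mem_plusPart {v : V} : v ∈ plusPart F α a ↔
    ∃ x ∈ eigSp F a 1, ∃ y ∈ eigSp F a 0, ∃ z ∈ eigSp F a α, v = x + y + z := by
  simp only [plusPart, Submodule.mem_sup]
  constructor
  · rintro ⟨_, ⟨x, hx, y, hy, rfl⟩, z, hz, rfl⟩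
    exact ⟨x, hx, y, hy, z, hz, rfl⟩
  · rintro ⟨x, hx, y, hy, z, hz, rfl⟩
    exact ⟨_, ⟨x, hx, y, hy, rfl⟩, z, hz, rfl⟩

theorem IsAxis.plus_mul_plus (h : IsAxis F α β a) {v w : V} (hv : v ∈ plusPart F α a)
    (hw : w ∈ plusPart F α a) : v * w ∈ plusPart F α a := by
  obtain ⟨x, hx, y, hy, z, hz, rfl⟩ := mem_plusPart.1 hv
  obtain ⟨x', hx', y', hy', z', hz', rfl⟩ := mem_plusPart.1 hw
  have i1 : eigSp F a 1 ≤ plusPart F α a := le_sup_of_le_left le_sup_left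
  have i0 : eigSp F a 0 ≤ plusPart F α a := le_sup_of_le_left le_sup_right
  have iα : eigSp F a α ≤ plusPart F α a := le_sup_right
  have i10 : eigSp F a 1 ⊔ eigSp F a 0 ≤ plusPart F α a := le_sup_left
  simp only [mul_add, add_mul, mul_comm y x', mul_comm z x', mul_comm z y',
    h.fusion_one_zero x hx y' hy', h.fusion_one_zero x' hx' y hy]
  refine add_mem (add_mem (add_mem (add_mem ?_ (zero_mem _)) ?_)
    (add_mem (add_mem (zero_mem _) ?_) ?_)) (add_mem (add_mem ?_ ?_) ?_)
  · exact i1 (h.fusion_one_one x hx x' hx')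
  · exact iα (h.fusion_one_alpha x' hx' z hz)
  · exact i0 (h.fusion_zero_zero y hy y' hy')
  · exact iα (h.fusion_zero_alpha y' hy' z hz)
  · exact iα (h.fusion_one_alpha x hx z' hz')
  · exact iα (h.fusion_zero_alpha y hy z' hz')
  · exact i10 (h.fusion_alpha_alpha z hz z' hz')

theorem IsAxis.plus_mul_beta (h : IsAxis F α β a) {v w : V} (hv : v ∈ plusPart F α a)
    (hw : w ∈ eigSp F a β) : v * w ∈ eigSp F a β := by
  obtain ⟨x, hx, y, hy, z, hz, rfl⟩ := mem_plusPart.1 hv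
  rw [add_mul, add_mul]
  exact add_mem (add_mem (h.fusion_one_beta x hx w hw) (h.fusion_zero_beta y hy w hw))
    (h.fusion_alpha_beta z hz w hw)

/-- The Miyamoto involution is multiplicative. -/
theorem miyamoto_mul (h : IsAxis F α β a) (v w : V) :
    miyamoto h (v * w) = miyamoto h v * miyamoto h w := by
  obtain ⟨p, hp, q, hq, rfl⟩ := h.exists_plus_beta v
  obtain ⟨r, hr, t, ht, rfl⟩ := h.exists_plus_beta w
  have hqr : q * r ∈ eigSp F a β := by
    rw [mul_comm]
    exact h.plus_mul_beta hr hq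
  simp only [mul_add, add_mul, map_add, miyamoto_plus h hp, miyamoto_beta h hq,
    miyamoto_plus h hr, miyamoto_beta h ht, miyamoto_plus h (h.plus_mul_plus hp hr),
    miyamoto_beta h hqr, miyamoto_beta h (h.plus_mul_beta hp ht),
    miyamoto_plus h (h.fusion_beta_beta q hq t ht), neg_mul, mul_neg]
  abel

theorem miyamoto_self (h : IsAxis F α β a) : miyamoto h a = a := by
  have hle : eigSp F a 1 ≤ plusPart F α a := le_sup_of_le_left le_sup_left
  refine miyamoto_plus h (hle ?_)
  rw [mem_eigSp, h.idem, one_smul]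

variable [IsScalarTower F V V]

/-- If the Miyamoto involution of an axis fixes a generating set, its `β`-eigenspace is zero. -/
theorem IsAxis.eigSp_beta_eq_bot (hchar : ringChar F ≠ 2) (h : IsAxis F α β a) {S : Set V}
    (hS : NonUnitalAlgebra.adjoin F S = ⊤) (hfix : ∀ x ∈ S, miyamoto h x = x) :
    eigSp F a β = ⊥ := by
  have hid : ∀ v, miyamoto h v = v := by
    intro v
    have hv : v ∈ NonUnitalAlgebra.adjoin F S := by
      rw [hS]
      trivial
    induction hv using NonUnitalAlgebra.adjoin_induction with
    | mem x hx => exact hfix x hx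
    | add x y _ _ hx hy => rw [map_add, hx, hy]
    | zero => exact map_zero _
    | mul x y _ _ hx hy => rw [miyamoto_mul, hx, hy]
    | smul r x _ hx => rw [map_smul, hx]
  rw [Submodule.eq_bot_iff]
  intro w hw
  have hneg : w = -w := (hid w).symm.trans (miyamoto_beta h hw)
  have h2 : (2 : F) • w = 0 := by
    rw [two_smul]
    nth_rewrite 2 [hneg]
    exact add_neg_cancel w
  exact (smul_eq_zero.1 h2).resolve_left (Ring.two_ne_zero hchar)

end Miyamoto

namespace IsTwoGenerated

variable {F : Type u} [Field F] {V : Type v} [NonUnitalNonAssocCommRing V]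
  [Module F V] [SMulCommClass F V V] [IsScalarTower F V V] {α β : F} {a₀ a₁ : V}

theorem axSeq_zero_eq_two_iff (hV : IsTwoGenerated F α β a₀ a₁) :
    hV.axSeq 0 = hV.axSeq 2 ↔ miyamoto hV.axis₁ a₀ = a₀ := by
  have h0 : hV.axSeq 0 = a₀ := by simp [axSeq]
  have h2 : hV.axSeq 2 = miyamoto hV.axis₁ a₀ := by
    simp [axSeq, rho, miyamoto_self]
  rw [h0, h2, eq_comm]

theorem axSeq_one_eq_neg_one_iff (hV : IsTwoGenerated F α β a₀ a₁) :
    hV.axSeq 1 = hV.axSeq (-1) ↔ miyamoto hV.axis₀ a₁ = a₁ := by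
  have h1 : hV.axSeq 1 = a₁ := by simp [axSeq]
  have h2 : hV.axSeq (-1) = hV.rho⁻¹ a₁ := by simp [axSeq]
  have h3 : hV.rho (hV.rho⁻¹ a₁) = a₁ := by
    rw [← LinearEquiv.mul_apply, mul_inv_cancel]
    rfl
  have h4 : hV.rho a₁ = miyamoto hV.axis₁ (miyamoto hV.axis₀ a₁) := rfl
  rw [h1, h2, ← hV.rho.injective.eq_iff, h3, h4]
  have h5 := miyamoto_self hV.axis₁
  exact ⟨fun h => (miyamoto hV.axis₁).injective (h.trans h5.symm),
    fun h => (congrArg (miyamoto hV.axis₁) h).trans h5⟩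

theorem orbit_eq_singleton_iff (hV : IsTwoGenerated F α β a₀ a₁) (v : V) :
    MulAction.orbit hV.miy v = {v} ↔
      miyamoto hV.axis₀ v = v ∧ miyamoto hV.axis₁ v = v := by
  constructor
  · intro h
    have key : ∀ g ∈ hV.miy, g v = v := fun g hg => by
      have : (⟨g, hg⟩ : hV.miy) • v ∈ ({v} : Set V) := h ▸ MulAction.mem_orbit _ _
      exact this
    exact ⟨key _ (Subgroup.subset_closure (by simp)), key _ (Subgroup.subset_closure (by simp))⟩
  · rintro ⟨h0, h1⟩
    have hle : hV.miy ≤ MulAction.stabilizer (V ≃ₗ[F] V) v := by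
      rw [miy, Subgroup.closure_le]
      rintro g (rfl | rfl)
      · exact h0
      · exact h1
    refine Set.Subset.antisymm ?_ (Set.singleton_subset_iff.2 (MulAction.mem_orbit_self v))
    rintro _ ⟨g, rfl⟩
    exact hle g.2

/-- In a regular axet one orbit is a singleton if and only if the other is. -/
theorem HasRegularAxet.orbit_singleton_iff {hV : IsTwoGenerated F α β a₀ a₁}
    (hreg : hV.HasRegularAxet) :
    MulAction.orbit hV.miy a₀ = {a₀} ↔ MulAction.orbit hV.miy a₁ = {a₁} := by
  have key : ∀ v : V, MulAction.orbit hV.miy v = {v} ↔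
      Cardinal.mk (MulAction.orbit hV.miy v) = 1 := by
    intro v
    constructor
    · intro h
      rw [h, Cardinal.mk_singleton]
    · intro h
      obtain ⟨w, hw⟩ := Cardinal.mk_set_eq_one_iff.1 h
      have hv : v ∈ MulAction.orbit hV.miy v := MulAction.mem_orbit_self v
      rw [hw] at hv ⊢
      rw [Set.mem_singleton_iff.1 hv]
  rw [key, key, hreg]

end IsTwoGenerated

end AxialFormal

theorem jordan_or_skew {F : Type*} [Field F] {V : Type*} [NonUnitalNonAssocCommRing V]
    [Module F V] [SMulCommClass F V V] [IsScalarTower F V V]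
    (hchar : ringChar F ≠ 2) {α β : F}
    (hα0 : α ≠ 0) (hα1 : α ≠ 1) (hβ0 : β ≠ 0) (hβ1 : β ≠ 1) (hαβ : α ≠ β)
    {a₀ a₁ : V} (hV : AxialFormal.IsTwoGenerated F α β a₀ a₁)
    (hcase : hV.axSeq 0 = hV.axSeq 2 ∨ hV.axSeq 1 = hV.axSeq (-1)) :
    (AxialFormal.eigSp F a₀ β = ⊥ ∧ AxialFormal.eigSp F a₁ β = ⊥ ∧
      AxialFormal.IsTwoGeneratedJordan F α a₀ a₁ ∧ AxialFormal.IsSymmetric F a₀ a₁) ∨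
    hV.HasSkewAxet := by
  by_cases hreg : hV.HasRegularAxet
  swap
  · exact Or.inr hreg
  left
  rw [hV.axSeq_zero_eq_two_iff, hV.axSeq_one_eq_neg_one_iff] at hcase
  have h00 := AxialFormal.miyamoto_self hV.axis₀
  have h11 := AxialFormal.miyamoto_self hV.axis₁
  have hiff := hreg.orbit_singleton_iff
  rw [hV.orbit_eq_singleton_iff, hV.orbit_eq_singleton_iff] at hiff
  have hfix : AxialFormal.miyamoto hV.axis₀ a₁ = a₁ ∧ AxialFormal.miyamoto hV.axis₁ a₀ = a₀ := by
    rcases hcase with h | h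
    · exact ⟨(hiff.1 ⟨h00, h⟩).1, h⟩
    · exact ⟨h, (hiff.2 ⟨h, h11⟩).2⟩
  have hb0 := hV.axis₀.eigSp_beta_eq_bot hchar hV.generates (by
    rintro x (rfl | rfl)
    · exact h00
    · exact hfix.1)
  have hb1 := hV.axis₁.eigSp_beta_eq_bot hchar hV.generates (by
    rintro x (rfl | rfl)
    · exact hfix.2
    · exact h11)
  have hJ : AxialFormal.IsTwoGeneratedJordan F α a₀ a₁ :=
    ⟨hV.axis₀.isJordanAxis hb0, hV.axis₁.isJordanAxis hb1, hV.generates⟩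
  exact ⟨hb0, hb1, hJ, hJ.isSymmetric hα0 hα1⟩
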